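/- arXiv:2312.07924 — 2 statements merged into one kernel-verified Lean document; each statement's English description precedes it below -/
import Mathlib

section
/- Let (g, [·,·]) be a finite-dimensional real semisimple Lie algebra and let g = m ⊕ h be a strong decomposition, i.e., m = m₁ ⊕ ⋯ ⊕ m_k with each m_i a simple h-submodule and [m_i, m_i] ≠ 0. Then the only commutative, associative, ad(h)-invariant bilinear product on m is the zero product. -/
lemma idem_aux {V : Type*} [AddCommGroup V] [Module ℝ V] [FiniteDimensional ℝ V]
    (γ : V →ₗ[ℝ] V →ₗ[ℝ] V) (hc : ∀ u v, γ u v = γ v u)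
    (ha : ∀ u v w, γ (γ u v) w = γ u (γ v w)) (P : Submodule ℝ V)
    (hP : P ≤ Submodule.span ℝ {x | ∃ u ∈ P, ∃ v ∈ P, x = γ u v}) :
    ∃ e, γ e e = e ∧ ∀ v ∈ P, γ e v = v := by
  let : NonUnitalCommRing V :=
    { ‹AddCommGroup V› with
      mul := fun u v => γ u v
      left_distrib := fun a b c => by change γ a (b + c) = γ a b + γ a c; simp
      right_distrib := fun a b c => by change γ (a + b) c = γ a c + γ b c; simp
      zero_mul := fun a => by change γ 0 a = 0; simp
      mul_zero := fun a => by change γ a 0 = 0; simp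
      mul_assoc := ha
      mul_comm := hc }
  have hmul : ∀ u v : V, u * v = γ u v := fun _ _ => rfl
  have : IsScalarTower ℝ V V := ⟨fun r u v => by change γ (r • u) v = r • γ u v; simp⟩
  have : SMulCommClass ℝ V V := ⟨fun r u v => by change r • γ u v = γ u (r • v); simp⟩
  let N : Ideal (Unitization ℝ V) := Ideal.span ((Unitization.inr : V → Unitization ℝ V) '' P)
  have hinr : ∀ x ∈ P, (Unitization.inr x : Unitization ℝ V) ∈ N :=
    fun x hx => Ideal.subset_span ⟨x, hx, rfl⟩
  obtain ⟨s, hs⟩ := (IsNoetherian.noetherian P : P.FG)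
  have hN : N.FG := by
    classical
    refine ⟨s.image (Unitization.inr : V → Unitization ℝ V), le_antisymm ?_ ?_⟩
    · refine Ideal.span_mono ?_
      rw [Finset.coe_image]
      exact Set.image_mono (hs ▸ Submodule.subset_span)
    · refine Ideal.span_le.2 ?_
      rintro _ ⟨x, hx, rfl⟩
      replace hx : x ∈ Submodule.span ℝ (s : Set V) := hs ▸ hx
      induction hx using Submodule.span_induction with
      | mem x h => exact Ideal.subset_span (by simpa using h)
      | zero => simp
      | add x y _ _ h1 h2 => simpa using Ideal.add_mem _ h1 h2
      | smul r x _ h => 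
        have := Ideal.mul_mem_left (Ideal.span (s.image (Unitization.inr : V → Unitization ℝ V) : Set (Unitization ℝ V))) (Unitization.inl r) h
        rw [Unitization.inl_mul_inr] at this
        exact this
  have hid : IsIdempotentElem N := by
    refine le_antisymm Ideal.mul_le_left ?_
    refine Ideal.span_le.2 ?_
    rintro _ ⟨x, hx, rfl⟩
    replace hx := hP hx
    induction hx using Submodule.span_induction with
    | mem x h => 
      obtain ⟨u, hu, v, hv, rfl⟩ := h
      rw [← hmul, Unitization.inr_mul]
      exact Ideal.mul_mem_mul (hinr _ hu) (hinr _ hv)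
    | zero => simp
    | add x y _ _ h1 h2 => simpa using Ideal.add_mem _ h1 h2
    | smul r x _ h => 
      have := Ideal.mul_mem_left (N * N) (Unitization.inl r) h
      rw [Unitization.inl_mul_inr] at this
      exact this
  obtain ⟨e, he, hNe⟩ := (Ideal.isIdempotentElem_iff_of_fg N hN).1 hid
  have heN : e ∈ N := hNe ▸ Ideal.mem_span_singleton_self e
  have hker : N ≤ RingHom.ker (Unitization.fstHom ℝ V) := by
    refine Ideal.span_le.2 ?_
    rintro _ ⟨x, hx, rfl⟩
    simp [RingHom.mem_ker]
  have hfst : e.fst = 0 := hker heN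
  have hee : e = Unitization.inr e.snd := by
    ext <;> simp [hfst]
  refine ⟨e.snd, ?_, ?_⟩
  · have h : e * e = e := he
    rw [hee, ← Unitization.inr_mul] at h
    exact Unitization.inr_injective h
  · intro v hv
    have h1 : (Unitization.inr v : Unitization ℝ V) ∈ Ideal.span {e} := by
      rw [Ideal.span, ← hNe]; exact hinr v hv
    obtain ⟨c, hcc⟩ := Ideal.mem_span_singleton.1 h1
    have h2 : e * Unitization.inr v = (Unitization.inr v : Unitization ℝ V) := by
      rw [hcc, ← mul_assoc, he.eq]
    rw [hee, ← Unitization.inr_mul] at h2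
    exact Unitization.inr_injective h2

lemma kill_hm (g : Type*) [LieRing g] [LieAlgebra ℝ g] [FiniteDimensional ℝ g]
    (𝔪 𝔥 : Submodule ℝ g)
    (hcompl : IsCompl 𝔪 𝔥)
    (hsubalg : ∀ a ∈ 𝔥, ∀ b ∈ 𝔥, ⁅a, b⁆ ∈ 𝔥)
    (hhm : ∀ a ∈ 𝔥, ∀ u ∈ 𝔪, ⁅a, u⁆ ∈ 𝔪)
    (hmm : ∀ u ∈ 𝔪, ∀ v ∈ 𝔪, ⁅u, v⁆ ∈ 𝔥) :
    ∀ u ∈ 𝔪, ∀ a ∈ 𝔥, killingForm ℝ g u a = 0 := by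
  intro u hu a ha
  have hhm' : ∀ u ∈ 𝔪, ∀ a ∈ 𝔥, ⁅u, a⁆ ∈ 𝔪 := fun u hu a ha => by
    rw [← lie_skew]; exact 𝔪.neg_mem (hhm a ha u hu)
  rw [killingForm_apply_apply]
  have hint : DirectSum.IsInternal (fun b : Bool => if b then 𝔪 else 𝔥) := by
    rw [DirectSum.isInternal_submodule_iff_isCompl (i := true) (j := false)]
    · simpa using hcompl
    · simp
    · ext b; cases b <;> simp
  refine LinearMap.trace_eq_zero_of_mapsTo_ne hint (σ := not) (by simp) ?_
  intro b x hx
  cases b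
  · have hx : x ∈ 𝔥 := by simpa using hx
    simpa using hhm' u hu _ (hsubalg a ha x hx)
  · have hx : x ∈ 𝔪 := by simpa using hx
    simpa using hmm u hu _ (hhm a ha x hx)

lemma struct_aux (g : Type*) [LieRing g] [LieAlgebra ℝ g] [FiniteDimensional ℝ g]
    [LieAlgebra.IsSemisimple ℝ g]
    (𝔪 𝔥 : Submodule ℝ g)
    (hcompl : IsCompl 𝔪 𝔥)
    (hsubalg : ∀ a ∈ 𝔥, ∀ b ∈ 𝔥, ⁅a, b⁆ ∈ 𝔥)
    (hhm : ∀ a ∈ 𝔥, ∀ u ∈ 𝔪, ⁅a, u⁆ ∈ 𝔪)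
    (hmm : ∀ u ∈ 𝔪, ∀ v ∈ 𝔪, ⁅u, v⁆ ∈ 𝔥)
    (M : Submodule ℝ g)
    (hle : M ≤ 𝔪)
    (hstab : ∀ a ∈ 𝔥, ∀ u ∈ M, ⁅a, u⁆ ∈ M)
    (hsimple : ∀ p : Submodule ℝ g, p ≤ M →
      (∀ a ∈ 𝔥, ∀ u ∈ p, ⁅a, u⁆ ∈ p) → p = ⊥ ∨ p = M)
    (hbr : ∃ u ∈ M, ∃ v ∈ M, ⁅u, v⁆ ≠ (0 : g)) :
    (∀ u ∈ M, ∀ v ∈ M, ∀ w ∈ 𝔪, ⁅⁅u, v⁆, w⁆ ∈ M) ∧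
    (∀ x ∈ M, (∀ u ∈ M, ∀ v ∈ M, ⁅⁅u, v⁆, x⁆ = 0) → x = 0) ∧
    (M ≤ Submodule.span ℝ {x | ∃ u ∈ M, ∃ v ∈ M, ∃ w ∈ M, x = ⁅⁅u, v⁆, w⁆}) := by
  have hKill : LieAlgebra.IsKilling ℝ g := inferInstance
  have hK0 := kill_hm g 𝔪 𝔥 hcompl hsubalg hhm hmm
  have hsym : ∀ x y, killingForm ℝ g x y = killingForm ℝ g y x :=
    LieModule.traceForm_comm ℝ g g
  have hinv : ∀ x y z, killingForm ℝ g ⁅x, y⁆ z = killingForm ℝ g x ⁅y, z⁆ :=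
    LieModule.traceForm_apply_lie_apply ℝ g g
  have hsplit : ∀ x : g, ∃ u ∈ 𝔪, ∃ a ∈ 𝔥, x = u + a := by
    intro x
    have : x ∈ 𝔪 ⊔ 𝔥 := by rw [hcompl.sup_eq_top]; trivial
    obtain ⟨u, hu, a, ha, h⟩ := Submodule.mem_sup.1 this
    exact ⟨u, hu, a, ha, h.symm⟩
  have hnd : ∀ c ∈ 𝔥, (∀ b ∈ 𝔥, killingForm ℝ g c b = 0) → c = 0 := by
    intro c hc h
    have : c ∈ LinearMap.ker (killingForm ℝ g) := by
      rw [LinearMap.mem_ker]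
      ext x
      obtain ⟨u, hu, a, ha, rfl⟩ := hsplit x
      rw [map_add, h a ha, hsym, hK0 u hu c hc]; simp
    simpa using this
  -- orthogonal implies commuting
  have hort : ∀ q : Submodule ℝ g, q ≤ 𝔪 → (∀ a ∈ 𝔥, ∀ u ∈ q, ⁅a, u⁆ ∈ q) →
      (∀ u ∈ M, ∀ v ∈ q, killingForm ℝ g u v = 0) → ∀ u ∈ M, ∀ v ∈ q, ⁅u, v⁆ = 0 := by
    intro q hq hqs h u hu v hv
    refine hnd _ (hmm u (hle hu) v (hq hv)) fun b hb => ?_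
    rw [hinv]
    refine h u hu _ ?_
    rw [← lie_skew]
    exact q.neg_mem (hqs b hb v hv)
  have hstabort : ∀ a ∈ 𝔥, ∀ w, (∀ y ∈ M, killingForm ℝ g y w = 0) →
      (∀ y ∈ M, killingForm ℝ g y ⁅a, w⁆ = 0) := by
    intro a ha w hw y hy
    rw [← hinv, ← lie_skew, map_neg, LinearMap.neg_apply, hw _ (hstab a ha y hy), neg_zero]
  have hdisj : Disjoint M ((killingForm ℝ g).orthogonal M) := by
    rw [disjoint_iff]
    rcases hsimple (M ⊓ (killingForm ℝ g).orthogonal M) inf_le_left (by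
      rintro a ha u ⟨hu, hu'⟩
      exact ⟨hstab a ha u hu, hstabort a ha u hu'⟩) with h | h
    · exact h
    · exfalso
      obtain ⟨u, hu, v, hv, huv⟩ := hbr
      refine huv (hort M hle hstab ?_ u hu v hv)
      intro u hu v hv
      rw [← h] at hv
      exact hv.2 u hu
  have hcomplM : IsCompl M ((killingForm ℝ g).orthogonal M) :=
    (LinearMap.BilinForm.isCompl_orthogonal_iff_disjoint
      (LieModule.traceForm_isSymm ℝ g g).isRefl).2 hdisj
  -- splitting of 𝔪
  have hsp : ∀ w ∈ 𝔪, ∃ p ∈ M, ∃ n, (∀ u ∈ M, ⁅u, n⁆ = 0) ∧ w = p + n := by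
    intro w hw
    have : w ∈ M ⊔ (killingForm ℝ g).orthogonal M := by rw [hcomplM.sup_eq_top]; trivial
    obtain ⟨p, hp, n, hn, h⟩ := Submodule.mem_sup.1 this
    refine ⟨p, hp, n, fun u hu => ?_, h.symm⟩
    refine hort (𝔪 ⊓ (killingForm ℝ g).orthogonal M) inf_le_left ?_ ?_ u hu n ⟨?_, hn⟩
    · rintro a ha u ⟨hu, hu'⟩
      exact ⟨hhm a ha u hu, hstabort a ha u hu'⟩
    · intro u hu v hv
      exact hv.2 u hu
    · rw [← h] at hw
      exact (Submodule.add_mem_iff_right _ (hle hp)).1 hw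
  have hsp2 : ∀ w ∈ 𝔪, ∃ p ∈ M, ∀ u ∈ M, ∀ v ∈ M, ⁅⁅u, v⁆, w⁆ = ⁅⁅u, v⁆, p⁆ := by
    intro w hw
    obtain ⟨p, hp, n, hn, rfl⟩ := hsp w hw
    refine ⟨p, hp, fun u hu v hv => ?_⟩
    rw [lie_add, lie_lie u v n, hn v hv, hn u hu]; simp
  -- a bracket killing 𝔪 vanishes
  have hvan : ∀ u ∈ 𝔪, ∀ v ∈ 𝔪, (∀ w ∈ 𝔪, ⁅⁅u, v⁆, w⁆ = 0) → ⁅u, v⁆ = 0 := by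
    intro u hu v hv hc
    have hhm' : ∀ u ∈ 𝔪, ∀ a ∈ 𝔥, ⁅u, a⁆ ∈ 𝔪 := fun u hu a ha => by
      rw [← lie_skew]; exact 𝔪.neg_mem (hhm a ha u hu)
    refine hnd _ (hmm u hu v hv) fun b hb => ?_
    have hcc : ∀ x ∈ 𝔪, ∀ y ∈ 𝔪, ⁅⁅u, v⁆, ⁅x, y⁆⁆ = 0 := by
      intro x hx y hy
      rw [leibniz_lie, hc x hx, hc y hy]; simp
    have hcb : ∀ x ∈ 𝔪, ∀ y ∈ 𝔪, ⁅⁅u, v⁆, ⁅b, ⁅x, y⁆⁆⁆ = 0 := by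
      intro x hx y hy
      rw [leibniz_lie b x y, lie_add, hcc _ (hhm b hb x hx) y hy, hcc x hx _ (hhm b hb y hy)]
      simp
    rw [killingForm_apply_apply]
    refine (LinearMap.isNilpotent_trace_of_isNilpotent ⟨2, ?_⟩).eq_zero
    ext x
    obtain ⟨z, hz, a, ha, rfl⟩ := hsplit x
    rw [pow_two]
    simp only [Module.End.mul_apply, LinearMap.comp_apply, LieAlgebra.ad_apply,
      LinearMap.zero_apply, lie_add]
    rw [hc _ (hhm b hb z hz), lie_lie u v ⁅b, a⁆]
    have hba := hsubalg b hb a ha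
    simp only [lie_sub, lie_zero, zero_add]
    rw [hcb u hu _ (hhm' v hv _ hba), hcb v hv _ (hhm' u hu _ hba)]
    simp
  have hnk : ¬ ∀ x ∈ M, ∀ u ∈ M, ∀ v ∈ M, ⁅⁅u, v⁆, x⁆ = 0 := by
    intro h
    obtain ⟨u, hu, v, hv, huv⟩ := hbr
    refine huv (hvan u (hle hu) v (hle hv) fun w hw => ?_)
    obtain ⟨p, hp, hpw⟩ := hsp2 w hw
    rw [hpw u hu v hv, h p hp u hu v hv]
  have hder : ∀ a u v x : g, ⁅a, ⁅⁅u, v⁆, x⁆⁆ =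
      ⁅⁅⁅a, u⁆, v⁆, x⁆ + ⁅⁅u, ⁅a, v⁆⁆, x⁆ + ⁅⁅u, v⁆, ⁅a, x⁆⁆ := by
    intro a u v x
    rw [leibniz_lie a ⁅u, v⁆ x, leibniz_lie a u v, add_lie]
  refine ⟨?_, ?_, ?_⟩
  · intro u hu v hv w hw
    obtain ⟨p, hp, hpw⟩ := hsp2 w hw
    rw [hpw u hu v hv]
    exact hstab _ (hmm u (hle hu) v (hle hv)) p hp
  · let Z : Submodule ℝ g :=
      { carrier := {x | x ∈ M ∧ ∀ u ∈ M, ∀ v ∈ M, ⁅⁅u, v⁆, x⁆ = 0}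
        zero_mem' := ⟨M.zero_mem, by simp⟩
        add_mem' := by
          rintro x y ⟨hx, hx'⟩ ⟨hy, hy'⟩
          refine ⟨M.add_mem hx hy, fun u hu v hv => ?_⟩
          rw [lie_add, hx' u hu v hv, hy' u hu v hv, add_zero]
        smul_mem' := by
          rintro r x ⟨hx, hx'⟩
          refine ⟨M.smul_mem r hx, fun u hu v hv => ?_⟩
          rw [lie_smul, hx' u hu v hv, smul_zero] }
    have hZ : Z = ⊥ := by
      rcases hsimple Z (fun x hx => hx.1) (by
        rintro a ha x ⟨hx, hx'⟩
        refine ⟨hstab a ha x hx, fun u hu v hv => ?_⟩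
        have := hder a u v x
        rw [hx' u hu v hv, hx' _ (hstab a ha u hu) v hv, hx' u hu _ (hstab a ha v hv)] at this
        simpa using this.symm) with h | h
      · exact h
      · exfalso
        refine hnk fun x hx => ?_
        rw [← h] at hx
        exact hx.2
    intro x hx hx'
    have : x ∈ Z := ⟨hx, hx'⟩
    rw [hZ] at this
    simpa using this
  · have hsub : Submodule.span ℝ {x | ∃ u ∈ M, ∃ v ∈ M, ∃ w ∈ M, x = ⁅⁅u, v⁆, w⁆} ≤ M := by
      refine Submodule.span_le.2 ?_
      rintro _ ⟨u, hu, v, hv, w, hw, rfl⟩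
      exact hstab _ (hmm u (hle hu) v (hle hv)) w hw
    rcases hsimple _ hsub (by
      intro a ha x hx
      induction hx using Submodule.span_induction with
      | mem x h =>
        obtain ⟨u, hu, v, hv, w, hw, rfl⟩ := h
        rw [hder]
        refine Submodule.add_mem _ (Submodule.add_mem _ ?_ ?_) ?_ <;> apply Submodule.subset_span
        · exact ⟨_, hstab a ha u hu, v, hv, w, hw, rfl⟩
        · exact ⟨u, hu, _, hstab a ha v hv, w, hw, rfl⟩
        · exact ⟨u, hu, v, hv, _, hstab a ha w hw, rfl⟩
      | zero => simp
      | add x y _ _ h1 h2 => rw [lie_add]; exact Submodule.add_mem _ h1 h2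
      | smul r x _ h => rw [lie_smul]; exact Submodule.smul_mem _ r h) with h | h
    · exfalso
      refine hnk fun x hx u hu v hv => ?_
      have : ⁅⁅u, v⁆, x⁆ ∈ Submodule.span ℝ {x | ∃ u ∈ M, ∃ v ∈ M, ∃ w ∈ M, x = ⁅⁅u, v⁆, w⁆} :=
        Submodule.subset_span ⟨u, hu, v, hv, x, hx, rfl⟩
      rw [h] at this
      simpa using this
    · exact h.ge


/-- For a finite-dimensional semisimple real Lie algebra with a strong
decomposition g = m ⊕ h, m = m₁ ⊕ ⋯ ⊕ m_k, the only commutative, associative,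
ad(h)-invariant bilinear product on m is the zero product. -/
theorem stmt_10 (g : Type*) [LieRing g] [LieAlgebra ℝ g] [FiniteDimensional ℝ g]
    [LieAlgebra.IsSemisimple ℝ g]
    (𝔪 𝔥 : Submodule ℝ g)
    (hcompl : IsCompl 𝔪 𝔥)
    (hsubalg : ∀ a ∈ 𝔥, ∀ b ∈ 𝔥, ⁅a, b⁆ ∈ 𝔥)
    (hhm : ∀ a ∈ 𝔥, ∀ u ∈ 𝔪, ⁅a, u⁆ ∈ 𝔪)
    (hmm : ∀ u ∈ 𝔪, ∀ v ∈ 𝔪, ⁅u, v⁆ ∈ 𝔥)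
    (k : ℕ) (M : Fin k → Submodule ℝ g)
    (hle : ∀ i, M i ≤ 𝔪)
    (hstab : ∀ i, ∀ a ∈ 𝔥, ∀ u ∈ M i, ⁅a, u⁆ ∈ M i)
    (hindep : iSupIndep M)
    (hsum : ⨆ i, M i = 𝔪)
    (hMne : ∀ i, M i ≠ ⊥)
    (hsimple : ∀ i, ∀ p : Submodule ℝ g, p ≤ M i →
      (∀ a ∈ 𝔥, ∀ u ∈ p, ⁅a, u⁆ ∈ p) → p = ⊥ ∨ p = M i)
    (hbr : ∀ i, ∃ u ∈ M i, ∃ v ∈ M i, ⁅u, v⁆ ≠ (0 : g))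
    (α : 𝔪 →ₗ[ℝ] 𝔪 →ₗ[ℝ] 𝔪)
    (hinva : ∀ a ∈ 𝔥, ∀ u v au av : 𝔪, (au : g) = ⁅a, (u : g)⁆ → (av : g) = ⁅a, (v : g)⁆ →
      ⁅a, ((α u v : 𝔪) : g)⁆ = ((α au v : 𝔪) : g) + ((α u av : 𝔪) : g))
    (hcomm : ∀ u v : 𝔪, α u v = α v u)
    (hassoc : ∀ u v w : 𝔪, α (α u v) w = α u (α v w)) :
    ∀ u v : 𝔪, α u v = 0 := by
  have hS := fun i => struct_aux g 𝔪 𝔥 hcompl hsubalg hhm hmm (M i) (hle i) (hstab i)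
    (hsimple i) (hbr i)
  let π : g →ₗ[ℝ] 𝔪 := 𝔪.projectionOnto 𝔥 hcompl
  have hπ : ∀ x : 𝔪, π (x : g) = x := fun x => Submodule.projectionOnto_apply_left hcompl x
  let γ : g →ₗ[ℝ] g →ₗ[ℝ] g := (α.compl₁₂ π π).compr₂ 𝔪.subtype
  have hγ : ∀ x y, γ x y = ((α (π x) (π y) : 𝔪) : g) := fun _ _ => rfl
  have hγm : ∀ x y, γ x y ∈ 𝔪 := fun x y => by rw [hγ]; exact Subtype.property _
  have hγc : ∀ x y, γ x y = γ y x := fun x y => by rw [hγ, hγ, hcomm]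
  have hγa : ∀ x y z, γ (γ x y) z = γ x (γ y z) := fun x y z => by
    simp only [hγ, hπ, hassoc]
  have hγi : ∀ a ∈ 𝔥, ∀ x ∈ 𝔪, ∀ y ∈ 𝔪, ⁅a, γ x y⁆ = γ ⁅a, x⁆ y + γ x ⁅a, y⁆ := by
    intro a ha x hx y hy
    have h1 := hπ ⟨_, hhm a ha x hx⟩
    have h2 := hπ ⟨_, hhm a ha y hy⟩
    simp only at h1 h2
    have h3 := hπ ⟨x, hx⟩
    have h4 := hπ ⟨y, hy⟩
    simp only at h3 h4
    simp only [hγ, h1, h2, h3, h4]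
    exact hinva a ha ⟨x, hx⟩ ⟨y, hy⟩ _ _ rfl rfl
  have hH : ∀ i, ∀ u ∈ M i, ∀ v ∈ M i, ⁅u, v⁆ ∈ 𝔥 := fun i u hu v hv =>
    hmm u (hle i hu) v (hle i hv)
  have hdis : ∀ i j, i ≠ j → ∀ x ∈ M i, x ∈ M j → x = 0 := fun i j hij x hx hx' =>
    Submodule.disjoint_def.1 (hindep.pairwiseDisjoint hij) x hx hx'
  have hF1 : ∀ i j, i ≠ j → ∀ u ∈ M i, ∀ v ∈ M i, ∀ w ∈ M j, ⁅⁅u, v⁆, w⁆ = 0 := by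
    intro i j hij u hu v hv w hw
    exact hdis i j hij _ ((hS i).1 u hu v hv w (hle j hw)) (hstab j _ (hH i u hu v hv) w hw)
  -- components
  have hdec : ∀ z ∈ 𝔪, ∃ f : Fin k → g, (∀ i, f i ∈ M i) ∧ z = ∑ i, f i ∧
      ∀ i, (∀ u ∈ M i, ∀ v ∈ M i, ⁅⁅u, v⁆, z⁆ = 0) → f i = 0 := by
    intro z hz
    rw [← hsum, Submodule.mem_iSup_iff_exists_finsupp] at hz
    obtain ⟨f, hf, rfl⟩ := hz
    have hfs : (f.sum fun _ x => x) = ∑ i, f i := Finsupp.sum_fintype _ _ (by simp)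
    refine ⟨f, hf, hfs, fun i hi => ?_⟩
    refine (hS i).2.1 _ (hf i) fun u hu v hv => ?_
    have := hi u hu v hv
    rw [hfs, lie_sum, Finset.sum_eq_single i] at this
    · exact this
    · intro j _ hj
      exact hF1 i j hj.symm u hu v hv _ (hf j)
    · simp
  have hmix : ∀ i j, i ≠ j → ∀ u ∈ M i, ∀ v ∈ M j, γ u v ∈ M i := by
    intro i j hij u hu v hv
    replace hu := (hS i).2.2 hu
    induction hu using Submodule.span_induction with
    | mem x h =>
      obtain ⟨p, hp, q, hq, w, hw, rfl⟩ := h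
      have h1 := hγi _ (hH i p hp q hq) w (hle i hw) v (hle j hv)
      rw [hF1 i j hij p hp q hq v hv, map_zero, add_zero] at h1
      rw [← h1]
      exact (hS i).1 p hp q hq _ (hγm _ _)
    | zero => simp
    | add x y _ _ h1 h2 =>
      rw [map_add, LinearMap.add_apply]; exact Submodule.add_mem _ h1 h2
    | smul r x _ h => rw [map_smul, LinearMap.smul_apply]; exact Submodule.smul_mem _ r h
  have hmix0 : ∀ i j, i ≠ j → ∀ u ∈ M i, ∀ v ∈ M j, γ u v = 0 := by
    intro i j hij u hu v hv
    refine hdis i j hij _ (hmix i j hij u hu v hv) ?_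
    rw [hγc]
    exact hmix j i hij.symm v hv u hu
  have hsame : ∀ i, ∀ u ∈ M i, ∀ v ∈ M i, γ u v ∈ M i := by
    intro i u hu v hv
    obtain ⟨f, hf, hz, hf0⟩ := hdec _ (hγm u v)
    have : ∀ j, j ≠ i → f j = 0 := by
      intro j hj
      refine hf0 j fun p hp q hq => ?_
      rw [hγi _ (hH j p hp q hq) u (hle i hu) v (hle i hv), hF1 j i hj p hp q hq u hu,
        hF1 j i hj p hp q hq v hv]
      simp
    rw [hz, Finset.sum_eq_single i (fun j _ hj => this j hj) (by simp)]
    exact hf i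
  have hsame0 : ∀ i, ∀ u ∈ M i, ∀ v ∈ M i, γ u v = 0 := by
    intro i
    have hsub : Submodule.span ℝ {x | ∃ u ∈ M i, ∃ v ∈ M i, x = γ u v} ≤ M i := by
      refine Submodule.span_le.2 ?_
      rintro _ ⟨u, hu, v, hv, rfl⟩
      exact hsame i u hu v hv
    rcases hsimple i _ hsub (by
      intro a ha x hx
      induction hx using Submodule.span_induction with
      | mem x h =>
        obtain ⟨u, hu, v, hv, rfl⟩ := h
        rw [hγi a ha u (hle i hu) v (hle i hv)]
        refine Submodule.add_mem _ ?_ ?_ <;> apply Submodule.subset_span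
        · exact ⟨_, hstab i a ha u hu, v, hv, rfl⟩
        · exact ⟨u, hu, _, hstab i a ha v hv, rfl⟩
      | zero => simp
      | add x y _ _ h1 h2 => rw [lie_add]; exact Submodule.add_mem _ h1 h2
      | smul r x _ h => rw [lie_smul]; exact Submodule.smul_mem _ r h) with h | h
    · intro u hu v hv
      have : γ u v ∈ Submodule.span ℝ {x | ∃ u ∈ M i, ∃ v ∈ M i, x = γ u v} :=
        Submodule.subset_span ⟨u, hu, v, hv, rfl⟩
      rw [h] at this
      simpa using this
    · exfalso
      obtain ⟨e, hee, he⟩ := idem_aux γ hγc hγa (M i) h.ge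
      have hem : e ∈ 𝔪 := hee ▸ hγm e e
      have hD : ∀ a ∈ 𝔥, ⁅a, e⁆ = 0 := by
        intro a ha
        have h1 := hγi a ha e hem e hem
        rw [hee, hγc ⁅a, e⁆ e] at h1
        have h2 : γ e ⁅a, e⁆ = γ e ⁅a, e⁆ + γ e ⁅a, e⁆ := by
          conv_lhs => rw [h1]
          rw [map_add, ← hγa, hee]
        have h3 : γ e ⁅a, e⁆ = 0 := by simpa using h2
        rw [h1, h3, add_zero]
      obtain ⟨f, hf, hz, hf0⟩ := hdec e hem
      have he0 : e = 0 := by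
        rw [hz]
        exact Finset.sum_eq_zero fun j _ => hf0 j fun u hu v hv => hD _ (hH j u hu v hv)
      refine hMne i ((Submodule.eq_bot_iff _).2 fun x hx => ?_)
      rw [← he x hx, he0]; simp
  have hall : ∀ i j, ∀ u ∈ M i, ∀ v ∈ M j, γ u v = 0 := by
    intro i j u hu v hv
    by_cases hij : i = j
    · subst hij; exact hsame0 i u hu v hv
    · exact hmix0 i j hij u hu v hv
  intro u v
  have hfin : γ u v = 0 := by
    obtain ⟨f, hf, hz, -⟩ := hdec u u.2
    obtain ⟨f', hf', hz', -⟩ := hdec v v.2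
    rw [hz, hz']
    simp only [map_sum, LinearMap.sum_apply]
    exact Finset.sum_eq_zero fun i _ => Finset.sum_eq_zero fun j _ => hall _ _ _ (hf _) _ (hf' _)
  rw [hγ, hπ, hπ] at hfin
  exact Subtype.ext hfin
end

section
/- Let g = m ⊕ h be the canonical decomposition of a symmetric pair and suppose the h-module m is irreducible with the isotropy representation ad^m : h → End(m) faithful and nontrivial. Then [h, m] = m, and the only commutative, associative, ad(h)-invariant bilinear product on m is the zero product. -/
theorem aux_unit {A : Type*} [NonUnitalCommRing A] [Module ℝ A] [IsScalarTower ℝ A A]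
    [SMulCommClass ℝ A A] [FiniteDimensional ℝ A]
    (h : Submodule.span ℝ {x : A | ∃ u v : A, x = u * v} = ⊤) : ∃ e : A, ∀ x : A, e * x = x := by
  have : Module.Finite ℝ (Unitization ℝ A) := 
    Module.Finite.of_surjective
      ((Algebra.linearMap ℝ (Unitization ℝ A)).coprod (Unitization.inrHom ℝ ℝ A))
      (fun y => ⟨(y.fst, y.snd), by ext <;> simp [Unitization.algebraMap_eq_inl]⟩)
  have : IsNoetherianRing (Unitization ℝ A) := IsNoetherianRing.of_finite ℝ _
  let I : Ideal (Unitization ℝ A) := RingHom.ker (Unitization.fstHom ℝ A)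
  have hmem : ∀ x : A, (x : Unitization ℝ A) ∈ I := fun x => by
    simp [I, RingHom.mem_ker]
  have hof : ∀ y ∈ I, y = ((y.snd : A) : Unitization ℝ A) := fun y hy => by
    have : y.fst = 0 := hy
    ext <;> simp [this]
  have hI : IsIdempotentElem I := by
    apply le_antisymm Ideal.mul_le_left
    intro y hy
    rw [hof y hy]
    have hx : y.snd ∈ Submodule.span ℝ {x : A | ∃ u v : A, x = u * v} := h ▸ Submodule.mem_top
    generalize y.snd = z at hx
    induction hx using Submodule.span_induction with
    | mem x hx =>
      obtain ⟨u, v, rfl⟩ := hx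
      rw [Unitization.inr_mul]
      exact Ideal.mul_mem_mul (hmem u) (hmem v)
    | zero => simp
    | add x y _ _ hx hy => rw [Unitization.inr_add]; exact add_mem hx hy
    | smul c x _ hx =>
      rw [Unitization.inr_smul, Algebra.smul_def]
      exact Ideal.mul_mem_left _ _ hx
  obtain ⟨e, he, hs⟩ := (Ideal.isIdempotentElem_iff_of_fg I (IsNoetherian.noetherian I)).1 hI
  have heI : e ∈ I := by rw [hs]; exact Ideal.mem_span_singleton_self e
  refine ⟨e.snd, fun x => ?_⟩
  have hx := hmem x
  rw [hs] at hx
  obtain ⟨c, hc⟩ := Ideal.mem_span_singleton.1 hx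
  apply Unitization.inr_injective (R := ℝ)
  rw [Unitization.inr_mul, ← hof e heI, hc, ← mul_assoc, he.eq]

theorem aux_unit' {A : Type*} [AddCommGroup A] [Module ℝ A] [FiniteDimensional ℝ A]
    (α : A →ₗ[ℝ] A →ₗ[ℝ] A) (hc : ∀ u v, α u v = α v u)
    (ha : ∀ u v w, α (α u v) w = α u (α v w))
    (h : Submodule.span ℝ {x : A | ∃ u v : A, x = α u v} = ⊤) : ∃ e : A, ∀ x : A, α e x = x := by
  let _ : NonUnitalCommRing A :=
    { (inferInstance : AddCommGroup A) with
      mul := fun u v => α u v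
      left_distrib := fun a b c => map_add (α a) b c
      right_distrib := fun a b c => by
        change α (a + b) c = α a c + α b c
        simp
      zero_mul := fun a => by
        change α 0 a = 0
        simp
      mul_zero := fun a => map_zero (α a)
      mul_assoc := ha
      mul_comm := hc }
  have : IsScalarTower ℝ A A := ⟨fun c x y => by
    change α (c • x) y = c • α x y
    simp⟩
  have : SMulCommClass ℝ A A := ⟨fun c x y => by
    change c • α x y = α x (c • y)
    simp⟩
  exact aux_unit (A := A) h

/-- If the h-module m of a symmetric pair is irreducible and the isotropy
representation is faithful and nontrivial, then [h,m] = m and the only commutative,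
associative, ad(h)-invariant bilinear product on m is the zero product. -/
theorem stmt_11 (g : Type*) [LieRing g] [LieAlgebra ℝ g] [FiniteDimensional ℝ g]
    (𝔪 𝔥 : Submodule ℝ g)
    (hcompl : IsCompl 𝔪 𝔥)
    (hsubalg : ∀ a ∈ 𝔥, ∀ b ∈ 𝔥, ⁅a, b⁆ ∈ 𝔥)
    (hhm : ∀ a ∈ 𝔥, ∀ u ∈ 𝔪, ⁅a, u⁆ ∈ 𝔪)
    (hmm : ∀ u ∈ 𝔪, ∀ v ∈ 𝔪, ⁅u, v⁆ ∈ 𝔥)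
    (hmne : 𝔪 ≠ ⊥)
    (hirr : ∀ p : Submodule ℝ g, p ≤ 𝔪 → (∀ a ∈ 𝔥, ∀ u ∈ p, ⁅a, u⁆ ∈ p) →
      p = ⊥ ∨ p = 𝔪)
    (hfaithful : ∀ a ∈ 𝔥, (∀ u ∈ 𝔪, ⁅a, u⁆ = (0 : g)) → a = 0)
    (hnontriv : ∃ a ∈ 𝔥, ∃ u ∈ 𝔪, ⁅a, u⁆ ≠ (0 : g)) :
    Submodule.span ℝ {x : g | ∃ a ∈ 𝔥, ∃ u ∈ 𝔪, x = ⁅a, u⁆} = 𝔪 ∧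
    (∀ α : 𝔪 →ₗ[ℝ] 𝔪 →ₗ[ℝ] 𝔪,
      (∀ u v : 𝔪, α u v = α v u) →
      (∀ u v w : 𝔪, α (α u v) w = α u (α v w)) →
      (∀ a ∈ 𝔥, ∀ u v au av : 𝔪, (au : g) = ⁅a, (u : g)⁆ → (av : g) = ⁅a, (v : g)⁆ →
        ⁅a, ((α u v : 𝔪) : g)⁆ = ((α au v : 𝔪) : g) + ((α u av : 𝔪) : g)) →
      ∀ u v : 𝔪, α u v = 0) := by
  have h1 : Submodule.span ℝ {x : g | ∃ a ∈ 𝔥, ∃ u ∈ 𝔪, x = ⁅a, u⁆} = 𝔪 := by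
    have hle : Submodule.span ℝ {x : g | ∃ a ∈ 𝔥, ∃ u ∈ 𝔪, x = ⁅a, u⁆} ≤ 𝔪 := by
      rw [Submodule.span_le]
      rintro _ ⟨a, ha, u, hu, rfl⟩
      exact hhm a ha u hu
    rcases hirr _ hle (fun a ha u hu => Submodule.subset_span ⟨a, ha, u, hle hu, rfl⟩) with h | h
    · exfalso
      obtain ⟨a, ha, u, hu, hne⟩ := hnontriv
      apply hne
      have : ⁅a, u⁆ ∈ Submodule.span ℝ {x : g | ∃ a ∈ 𝔥, ∃ u ∈ 𝔪, x = ⁅a, u⁆} :=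
        Submodule.subset_span ⟨a, ha, u, hu, rfl⟩
      rw [h] at this
      simpa using this
    · exact h
  refine ⟨h1, fun α hc has hinv => ?_⟩
  -- traces vanish
  have htr : ∀ x (hx : x ∈ 𝔪), LinearMap.trace ℝ 𝔪 (α ⟨x, hx⟩) = 0 := by
    intro x hx
    have hx' : x ∈ Submodule.map 𝔪.subtype (LinearMap.ker (LinearMap.trace ℝ 𝔪 ∘ₗ α)) := by
      have hle : 𝔪 ≤ Submodule.map 𝔪.subtype (LinearMap.ker (LinearMap.trace ℝ 𝔪 ∘ₗ α)) := by
        refine h1.ge.trans (Submodule.span_le.2 ?_)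
        rintro _ ⟨a, ha, u, hu, rfl⟩
        refine ⟨⟨⁅a, u⁆, hhm a ha u hu⟩, ?_, rfl⟩
        let D : 𝔪 →ₗ[ℝ] 𝔪 := (LieAlgebra.ad ℝ g a : g →ₗ[ℝ] g).restrict (hhm a ha)
        have key : α ⟨⁅a, u⁆, hhm a ha u hu⟩ = D * α ⟨u, hu⟩ - α ⟨u, hu⟩ * D := by
          ext v
          have := hinv a ha ⟨u, hu⟩ v ⟨⁅a, u⁆, hhm a ha u hu⟩ (D v) rfl rfl
          change _ = ⁅a, ((α ⟨u, hu⟩ v : 𝔪) : g)⁆ - ((α ⟨u, hu⟩ (D v) : 𝔪) : g)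
          rw [this]; simp
        change LinearMap.trace ℝ 𝔪 (α ⟨⁅a, u⁆, hhm a ha u hu⟩) = 0
        rw [key, map_sub, LinearMap.trace_mul_comm, sub_self]
      exact hle hx
    obtain ⟨y, hy, rfl⟩ := hx'
    exact hy
  let S : Submodule ℝ 𝔪 := Submodule.span ℝ {x : 𝔪 | ∃ u v : 𝔪, x = α u v}
  have hS : ∀ a ∈ 𝔥, ∀ u ∈ S.map 𝔪.subtype, ⁅a, u⁆ ∈ S.map 𝔪.subtype := by
    rintro a ha _ ⟨x, hx, rfl⟩
    let D : 𝔪 →ₗ[ℝ] 𝔪 := (LieAlgebra.ad ℝ g a : g →ₗ[ℝ] g).restrict (hhm a ha)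
    refine ⟨D x, ?_, rfl⟩
    have hle : S ≤ S.comap D := by
      refine Submodule.span_le.2 ?_
      rintro _ ⟨u, v, rfl⟩
      have : D (α u v) = α (D u) v + α u (D v) :=
        Subtype.ext (hinv a ha u v (D u) (D v) rfl rfl)
      change D (α u v) ∈ S
      rw [this]
      exact add_mem (Submodule.subset_span ⟨_, _, rfl⟩) (Submodule.subset_span ⟨_, _, rfl⟩)
    exact hle hx
  rcases hirr _ (Submodule.map_subtype_le 𝔪 S) hS with h | h
  · intro u v
    have : ((α u v : 𝔪) : g) ∈ S.map 𝔪.subtype :=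
      ⟨α u v, Submodule.subset_span ⟨u, v, rfl⟩, rfl⟩
    rw [h] at this
    exact Subtype.ext (by simpa using this)
  · exfalso
    have hST : S = ⊤ := by
      rw [eq_top_iff]
      intro x _
      have hx : (x : g) ∈ S.map 𝔪.subtype := h.ge x.2
      obtain ⟨y, hy, hyx⟩ := hx
      rwa [← Subtype.ext hyx]
    obtain ⟨e, he⟩ := aux_unit' α hc has hST
    have h2 := htr e e.2
    have h3 : α e = LinearMap.id := LinearMap.ext he
    change LinearMap.trace ℝ 𝔪 (α e) = 0 at h2
    rw [h3, LinearMap.trace_id] at h2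
    have h4 : Module.finrank ℝ 𝔪 = 0 := by exact_mod_cast h2
    exact hmne (Submodule.finrank_eq_zero.1 h4)
end
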